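/- arXiv:0908.2796 — 3 statements merged into one kernel-verified Lean document; each statement's English description precedes it below -/
import Mathlib

section
/- Let F be a field and A ∈ F nonzero; set q = A², {k} = (-A)^k - (-A)^{-k} for any integer k, {n}! = {1}···{n}, λ_i = -q^{i+1} - q^{-i-1}, and C^l_{m,n} = (-1)^l {m}!{n}!{m+n+1}! / ({m-l}!{n-l}!{m+n+1-l}!{l}!). Assume n+1 ≤ m and {k} ≠ 0 for all 1 ≤ k ≤ m+n+2. Then: (a) for all integers a, b ≥ 0, λ_a - λ_b = {b-a}·{a+b+2}; (b) C^0_{m,n+1} = C^0_{m,n}; (c) for 1 ≤ l ≤ n, C^l_{m,n+1} = C^l_{m,n} + (λ_{m+n-l+1} - λ_n)·C^{l-1}_{m,n}; (d) C^{n+1}_{m,n+1} = (λ_m - λ_n)·C^n_{m,n}. -/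
open Finset

/-- Quantum integer `{k} = (-A)^k - (-A)^(-k)`. -/
noncomputable def qint {F : Type*} [Field F] (A : F) (k : ℤ) : F :=
  (-A) ^ k - (-A) ^ (-k)

/-- Quantum factorial `{n}! = {1}{2}⋯{n}`, with `{0}! = 1`. -/
noncomputable def qfact {F : Type*} [Field F] (A : F) (n : ℕ) : F :=
  ∏ k ∈ Finset.range n, qint A ((k : ℤ) + 1)

/-- `λ_i = -q^(i+1) - q^(-i-1)` where `q = A²`. -/
noncomputable def lam {F : Type*} [Field F] (A : F) (i : ℕ) : F :=
  -(A ^ 2) ^ ((i : ℤ) + 1) - (A ^ 2) ^ (-(i : ℤ) - 1)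

/-- `C^l_{m,n} = (-1)^l {m}!{n}!{m+n+1}! / ({m-l}!{n-l}!{m+n+1-l}!{l}!)`. -/
noncomputable def Ccoef {F : Type*} [Field F] (A : F) (l m n : ℕ) : F :=
  (-1) ^ l * (qfact A m * qfact A n * qfact A (m + n + 1)) /
    (qfact A (m - l) * qfact A (n - l) * qfact A (m + n + 1 - l) * qfact A l)

theorem qint_mul_qint {F : Type*} [Field F] {A : F} (hA : A ≠ 0) (a b : ℤ) :
    qint A a * qint A b =
      ((-A) ^ (a + b) + (-A) ^ (-(a + b))) - ((-A) ^ (a - b) + (-A) ^ (-(a - b))) := by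
  have hx : -A ≠ 0 := neg_ne_zero.mpr hA
  rw [show -(a + b) = -a + -b by ring, show -(a - b) = -a + b by ring,
    show a - b = a + -b by ring]
  simp only [qint, zpow_add₀ hx]
  ring

theorem qint_neg {F : Type*} [Field F] (A : F) (a : ℤ) : qint A (-a) = -qint A a := by
  simp [qint]

theorem lam_sub_lam {F : Type*} [Field F] {A : F} (hA : A ≠ 0) (a b : ℕ) :
    lam A a - lam A b =
      qint A ((b : ℤ) - (a : ℤ)) * qint A ((a : ℤ) + (b : ℤ) + 2) := by
  have hlam (i : ℕ) :
      lam A i = -((-A) ^ (2 * ((i : ℤ) + 1)) + (-A) ^ (-(2 * ((i : ℤ) + 1)))) := by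
    rw [show -(2 * ((i : ℤ) + 1)) = 2 * (-(i : ℤ) - 1) by ring, zpow_mul, zpow_mul]
    simp only [lam, zpow_ofNat, neg_sq]
    ring
  rw [qint_mul_qint hA, hlam, hlam,
    show (b : ℤ) - a + (a + b + 2) = 2 * (b + 1) by ring,
    show (b : ℤ) - a - (a + b + 2) = -(2 * (a + 1)) by ring, neg_neg]
  ring

/-- The quantum-integer form of `a * b = (a - l) * (b - l) + l * (a + b - l)`. -/
theorem qint_mul_eq_add {F : Type*} [Field F] {A : F} (hA : A ≠ 0) (a b l : ℤ) :
    qint A a * qint A b =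
      qint A (a - l) * qint A (b - l) + qint A l * qint A (a + b - l) := by
  simp only [qint_mul_qint hA]
  ring_nf

theorem qfact_succ {F : Type*} [Field F] (A : F) (n : ℕ) :
    qfact A (n + 1) = qfact A n * qint A ((n : ℤ) + 1) :=
  Finset.prod_range_succ _ _

theorem qfact_ne_zero {F : Type*} [Field F] {A : F} {N : ℕ}
    (hk : ∀ k : ℕ, 1 ≤ k → k ≤ N → qint A (k : ℤ) ≠ 0) {n : ℕ} (hn : n ≤ N) :
    qfact A n ≠ 0 := by
  refine Finset.prod_ne_zero_iff.mpr fun k hkn => ?_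
  have := hk (k + 1) (by lia) (by have := Finset.mem_range.mp hkn; lia)
  exact_mod_cast this

/-- The recursion relations for `C^l_{m,n}` verified in the proof of Proposition 4.7:
(a) `λ_a - λ_b = {b-a}·{a+b+2}`; (b) `C^0_{m,n+1} = C^0_{m,n}`;
(c) `C^l_{m,n+1} = C^l_{m,n} + (λ_{m+n-l+1} - λ_n)·C^{l-1}_{m,n}` for `1 ≤ l ≤ n`;
(d) `C^{n+1}_{m,n+1} = (λ_m - λ_n)·C^n_{m,n}`. -/
theorem stmt1 {F : Type*} [Field F] (A : F) (hA : A ≠ 0) (m n : ℕ)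
    (hmn : n + 1 ≤ m)
    (hk : ∀ k : ℕ, 1 ≤ k → k ≤ m + n + 2 → qint A (k : ℤ) ≠ 0) :
    (∀ a b : ℕ, lam A a - lam A b =
        qint A ((b : ℤ) - (a : ℤ)) * qint A ((a : ℤ) + (b : ℤ) + 2)) ∧
    (Ccoef A 0 m (n + 1) = Ccoef A 0 m n) ∧
    (∀ l : ℕ, 1 ≤ l → l ≤ n →
      Ccoef A l m (n + 1) =
        Ccoef A l m n + (lam A (m + n - l + 1) - lam A n) * Ccoef A (l - 1) m n) ∧
    (Ccoef A (n + 1) m (n + 1) = (lam A m - lam A n) * Ccoef A n m n) := by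
  have hint (k : ℕ) (h : k + 1 ≤ m + n + 2) : qint A ((k : ℤ) + 1) ≠ 0 := by
    exact_mod_cast hk (k + 1) (by lia) h
  have hfact {k : ℕ} (h : k ≤ m + n + 2) : qfact A k ≠ 0 := qfact_ne_zero hk h
  refine ⟨lam_sub_lam hA, ?_, fun l hl hln => ?_, ?_⟩
  · have h1 := hfact (k := m) (by lia)
    have h2 := hfact (k := n) (by lia)
    have h3 := hfact (k := n + 1) (by lia)
    have h4 := hfact (k := m + n + 1) (by lia)
    have h5 := hfact (k := m + (n + 1) + 1) (by lia)
    simp only [Ccoef, Nat.sub_zero]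
    field_simp
  · obtain ⟨k, rfl⟩ : ∃ k, l = k + 1 := ⟨l - 1, by lia⟩
    obtain ⟨j, rfl⟩ : ∃ j, n = k + 1 + j := ⟨n - (k + 1), by lia⟩
    obtain ⟨i, rfl⟩ : ∃ i, m = k + 1 + i := ⟨m - (k + 1), by lia⟩
    have hi := hint i (by lia)
    have hj := hint j (by lia)
    have hk' := hint k (by lia)
    have hs := hint (k + 1 + i + j + 1) (by lia)
    have hfi := hfact (k := i) (by lia)
    have hfj := hfact (k := j) (by lia)
    have hfk := hfact (k := k) (by lia)
    have hfs := hfact (k := k + 1 + i + j + 1) (by lia)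
    have key := qint_mul_eq_add hA ((k + 1 + j : ℕ) + 1) ((k + 1 + i + (k + 1 + j) + 1 : ℕ) + 1)
      ((k : ℤ) + 1)
    rw [lam_sub_lam hA]
    simp only [Ccoef]
    rw [show k + 1 + i + (k + 1 + j) - (k + 1) + 1 = k + 1 + i + j + 1 by lia,
      show k + 1 + i - (k + 1) = i by lia,
      show k + 1 + j + 1 - (k + 1) = j + 1 by lia,
      show k + 1 + i + (k + 1 + j + 1) + 1 - (k + 1) = k + 1 + i + j + 1 + 1 by lia,
      show k + 1 + i + (k + 1 + j + 1) + 1 = k + 1 + i + (k + 1 + j) + 1 + 1 by lia,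
      show k + 1 + j - (k + 1) = j by lia,
      show k + 1 + i + (k + 1 + j) + 1 - (k + 1) = k + 1 + i + j + 1 by lia,
      show k + 1 - 1 = k by lia,
      show k + 1 + i - k = i + 1 by lia,
      show k + 1 + j - k = j + 1 by lia,
      show k + 1 + i + (k + 1 + j) + 1 - k = k + 1 + i + j + 1 + 1 by lia,
      qfact_succ A (k + 1 + j), qfact_succ A (k + 1 + i + (k + 1 + j) + 1),
      qfact_succ A j, qfact_succ A (k + 1 + i + j + 1), qfact_succ A i, qfact_succ A k,
      show ((k + 1 + j : ℕ) : ℤ) - (k + 1 + i + j + 1 : ℕ) = -((i : ℤ) + 1) by push_cast; ring,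
      qint_neg]
    rw [show ((k + 1 + j : ℕ) : ℤ) + 1 - (k + 1) = j + 1 by push_cast; ring,
      show ((k + 1 + i + (k + 1 + j) + 1 : ℕ) : ℤ) + 1 - (k + 1) =
        (k + 1 + i + j + 1 : ℕ) + 1 by push_cast; ring,
      show ((k + 1 + j : ℕ) : ℤ) + 1 + ((k + 1 + i + (k + 1 + j) + 1 : ℕ) + 1) - (k + 1) =
        (k + 1 + i + j + 1 : ℕ) + (k + 1 + j : ℕ) + 2 by push_cast; ring] at key
    generalize qint A ((k + 1 + i + j + 1 : ℕ) + (k + 1 + j : ℕ) + 2) = u at *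
    field_simp
    linear_combination (-1) ^ (k + 1) * qfact A (k + 1 + i) * qfact A (k + 1 + j) *
      qfact A (k + 1 + i + (k + 1 + j) + 1) * key
  · obtain ⟨i, rfl⟩ : ∃ i, m = n + 1 + i := ⟨m - (n + 1), by lia⟩
    have hi := hint i (by lia)
    have hfn := hfact (k := n) (by lia)
    have hfn' := hfact (k := n + 1) (by lia)
    rw [lam_sub_lam hA]
    simp only [Ccoef]
    rw [Nat.sub_self, Nat.sub_self,
      show n + 1 + i - (n + 1) = i by lia,
      show n + 1 + i + (n + 1) + 1 - (n + 1) = n + 1 + i + 1 by lia,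
      show n + 1 + i - n = i + 1 by lia,
      show n + 1 + i + n + 1 - n = n + 1 + i + 1 by lia,
      show n + 1 + i + (n + 1) + 1 = n + 1 + i + n + 1 + 1 by lia,
      qfact_succ A (n + 1 + i + n + 1), qfact_succ A i,
      show (n : ℤ) - (n + 1 + i : ℕ) = -((i : ℤ) + 1) by push_cast; ring, qint_neg,
      show ((n + 1 + i + n + 1 : ℕ) : ℤ) + 1 = (n + 1 + i : ℕ) + n + 2 by push_cast; ring]
    field_simp
    ring
end

section
/- Let p ≥ 5 be prime, d = (p-1)/2, ζ a primitive p-th root of unity, O = ℤ[ζ], h = 1-ζ, A = -ζ^{d+1}. Let 0 ≤ c ≤ d-1, 0 ≤ m ≤ n ≤ d-c-1, and 0 ≤ l ≤ m+c. Then the element b^{(c)}_{n,m,l} = C^{l}_{l+n-m, m+c} · ( γ_{l+n-m} / {l+n-m}! ) · ( {n}! / {m}! ) of ℚ(ζ) lies in O and is associated in O to h^l, i.e., equals (1-ζ)^l times a unit of O. -/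
open Finset

/-- `γ_m = (-A)^((m²+5m)/2) / ∏_{k=1}^{m}(A^(2k+1)-1)`. -/
noncomputable def gammaCoef {F : Type*} [Field F] (A : F) (m : ℕ) : F :=
  (-A) ^ ((m ^ 2 + 5 * m) / 2) / ∏ k ∈ Finset.Icc 1 m, (A ^ (2 * k + 1) - 1)

/-- The ring of cyclotomic integers `O = ℤ[ζ]`, as a subring of `ℂ`. -/
noncomputable def Oring (ζ : ℂ) : Subring ℂ := Subring.closure {ζ}

/-- `x` is a unit of the subring `S` times the integer power `h ^ k`. -/
def IsUnitMulZPow {K : Type*} [Field K] (S : Subring K) (h : K) (k : ℤ) (x : K) : Prop :=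
  ∃ u : Sˣ, x = ((u : S) : K) * h ^ k

namespace IsUnitMulZPow

variable {K : Type*} [Field K] {S : Subring K} {h x y : K} {j k : ℤ}

theorem of_isUnit {s : S} (hs : IsUnit s) : IsUnitMulZPow S h 0 (s : K) :=
  ⟨hs.unit, by simp⟩

theorem mul (hh : h ≠ 0) (hx : IsUnitMulZPow S h j x) (hy : IsUnitMulZPow S h k y) :
    IsUnitMulZPow S h (j + k) (x * y) := by
  obtain ⟨u, rfl⟩ := hx
  obtain ⟨v, rfl⟩ := hy
  refine ⟨u * v, ?_⟩
  rw [zpow_add₀ hh]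
  push_cast
  ring

theorem inv (hx : IsUnitMulZPow S h k x) : IsUnitMulZPow S h (-k) x⁻¹ := by
  obtain ⟨u, rfl⟩ := hx
  refine ⟨u⁻¹, ?_⟩
  have hu : ((u : S) : K) * ((u⁻¹ : Sˣ) : S) = 1 := by
    rw [← Subring.coe_mul, Units.mul_inv, Subring.coe_one]
  rw [mul_inv, zpow_neg, inv_eq_of_mul_eq_one_right hu]

theorem div (hh : h ≠ 0) (hx : IsUnitMulZPow S h j x) (hy : IsUnitMulZPow S h k y) :
    IsUnitMulZPow S h (j - k) (x / y) := by
  rw [div_eq_mul_inv, sub_eq_add_neg]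
  exact hx.mul hh hy.inv

theorem prod {ι : Type*} (hh : h ≠ 0) (s : Finset ι) {f : ι → K} {e : ι → ℤ}
    (hf : ∀ i ∈ s, IsUnitMulZPow S h (e i) (f i)) :
    IsUnitMulZPow S h (∑ i ∈ s, e i) (∏ i ∈ s, f i) := by
  classical
  induction s using Finset.induction_on with
  | empty => exact ⟨1, by simp⟩
  | insert a s ha ih =>
    rw [Finset.sum_insert ha, Finset.prod_insert ha]
    exact (hf a (by simp)).mul hh (ih fun i hi ↦ hf i (by simp [hi]))

end IsUnitMulZPow

section Cyclotomic

variable {p : ℕ} {ζ A : ℂ}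

/-- The generator `ζ` as an element of `ℤ[ζ]`. -/
noncomputable def Oring.gen (ζ : ℂ) : Oring ζ := ⟨ζ, Subring.subset_closure rfl⟩

theorem Oring.isPrimitiveRoot_gen (hζ : IsPrimitiveRoot ζ p) :
    IsPrimitiveRoot (Oring.gen ζ) p :=
  IsPrimitiveRoot.coe_submonoidClass_iff.mp hζ

theorem isUnitMulZPow_zeta_pow (hp : p.Prime) (hζ : IsPrimitiveRoot ζ p) (k : ℕ) :
    IsUnitMulZPow (Oring ζ) (1 - ζ) 0 (ζ ^ k) :=
  .of_isUnit (s := Oring.gen ζ ^ k)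
    (((Oring.isPrimitiveRoot_gen hζ).isUnit hp.ne_zero).pow k)

theorem isUnitMulZPow_zeta_pow_sub_one (hζ : IsPrimitiveRoot ζ p) {k : ℕ}
    (hk : k.Coprime p) : IsUnitMulZPow (Oring ζ) (1 - ζ) 1 (ζ ^ k - 1) := by
  obtain ⟨u, hu⟩ :=
    (Oring.isPrimitiveRoot_gen hζ).associated_sub_one_pow_sub_one_of_coprime hk
  have hu' : (ζ - 1) * ((u : Oring ζ) : ℂ) = ζ ^ k - 1 := congrArg Subtype.val hu
  refine ⟨-u, ?_⟩
  rw [← hu', zpow_one]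
  push_cast
  ring

theorem isUnitMulZPow_zeta_pow_add_one (hp : p.Prime) (hp2 : p ≠ 2)
    (hζ : IsPrimitiveRoot ζ p) {k : ℕ} (hk : k.Coprime p) :
    IsUnitMulZPow (Oring ζ) (1 - ζ) 0 (ζ ^ k + 1) := by
  have h := ((Oring.isPrimitiveRoot_gen hζ).pow_of_coprime k hk).geom_sum_isUnit hp.two_le
    ((Nat.coprime_primes Nat.prime_two hp).mpr hp2.symm)
  convert IsUnitMulZPow.of_isUnit (h := 1 - ζ) h using 1
  simp [Finset.sum_range_succ, Oring.gen, add_comm]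

theorem isUnitMulZPow_qint (hp : p.Prime) (hp2 : p ≠ 2) (hζ : IsPrimitiveRoot ζ p)
    (hA : A = -ζ ^ ((p - 1) / 2 + 1)) {k : ℕ} (hk0 : 0 < k) (hkp : k < p) :
    IsUnitMulZPow (Oring ζ) (1 - ζ) 1 (qint A k) := by
  have hζ0 : ζ ≠ 0 := hζ.ne_zero hp.ne_zero
  have hh : 1 - ζ ≠ 0 := sub_ne_zero.mpr (hζ.ne_one hp.one_lt).symm
  have hsq : (-A) ^ 2 = ζ := by
    have he : ((p - 1) / 2 + 1) * 2 = p + 1 := by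
      have := hp.eq_two_or_odd
      omega
    rw [hA, neg_neg, ← pow_mul, he, pow_succ, hζ.pow_eq_one, one_mul]
  have hA0 : -A ≠ 0 := by rw [hA, neg_neg]; exact pow_ne_zero _ hζ0
  have key : qint A k = (ζ ^ k - 1) / (-A) ^ k := by
    rw [qint, zpow_neg, zpow_natCast, eq_div_iff (pow_ne_zero _ hA0), sub_mul,
      inv_mul_cancel₀ (pow_ne_zero _ hA0), ← mul_pow, ← sq, hsq]
  rw [key, hA, neg_neg, ← pow_mul]
  simpa using (isUnitMulZPow_zeta_pow_sub_one hζ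
    (Nat.coprime_of_lt_prime hk0.ne' hkp hp).symm).div hh (isUnitMulZPow_zeta_pow hp hζ _)

theorem isUnitMulZPow_qfact (hp : p.Prime) (hp2 : p ≠ 2) (hζ : IsPrimitiveRoot ζ p)
    (hA : A = -ζ ^ ((p - 1) / 2 + 1)) {n : ℕ} (hn : n < p) :
    IsUnitMulZPow (Oring ζ) (1 - ζ) n (qfact A n) := by
  have hh : 1 - ζ ≠ 0 := sub_ne_zero.mpr (hζ.ne_one hp.one_lt).symm
  have h := IsUnitMulZPow.prod (S := Oring ζ) hh (Finset.range n) (e := fun _ ↦ 1)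
    (f := fun k ↦ qint A ((k : ℤ) + 1)) fun k hk ↦ by
      rw [Finset.mem_range] at hk
      exact_mod_cast isUnitMulZPow_qint hp hp2 hζ hA k.succ_pos (by omega)
  simpa [qfact] using h

theorem isUnitMulZPow_gammaCoef (hp : p.Prime) (hp2 : p ≠ 2) (hζ : IsPrimitiveRoot ζ p)
    (hA : A = -ζ ^ ((p - 1) / 2 + 1)) {m : ℕ} (hm : 2 * m + 1 < p) :
    IsUnitMulZPow (Oring ζ) (1 - ζ) 0 (gammaCoef A m) := by
  have hh : 1 - ζ ≠ 0 := sub_ne_zero.mpr (hζ.ne_one hp.one_lt).symm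
  have h := IsUnitMulZPow.prod (S := Oring ζ) hh (Finset.Icc 1 m) (e := fun _ ↦ 0)
    (f := fun k ↦ A ^ (2 * k + 1) - 1) fun k hk ↦ by
      rw [Finset.mem_Icc] at hk
      have hcop : (((p - 1) / 2 + 1) * (2 * k + 1)).Coprime p :=
        .mul_left (Nat.coprime_of_lt_prime (by omega) (by have := hp.two_le; omega) hp).symm
          (Nat.coprime_of_lt_prime (by omega) (by omega) hp).symm
      have hneg : A ^ (2 * k + 1) - 1 =
          ((-1 : Oring ζ) : ℂ) * (ζ ^ (((p - 1) / 2 + 1) * (2 * k + 1)) + 1) := by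
        rw [hA, Odd.neg_pow ⟨k, rfl⟩, ← pow_mul]
        push_cast
        ring
      rw [hneg]
      simpa using (IsUnitMulZPow.of_isUnit isUnit_one.neg).mul hh
        (isUnitMulZPow_zeta_pow_add_one hp hp2 hζ hcop)
  rw [gammaCoef]
  have hnum : IsUnitMulZPow (Oring ζ) (1 - ζ) 0 ((-A) ^ ((m ^ 2 + 5 * m) / 2)) := by
    rw [hA, neg_neg, ← pow_mul]
    exact isUnitMulZPow_zeta_pow hp hζ _
  simpa using hnum.div hh h

theorem isUnitMulZPow_Ccoef (hp : p.Prime) (hp2 : p ≠ 2) (hζ : IsPrimitiveRoot ζ p)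
    (hA : A = -ζ ^ ((p - 1) / 2 + 1)) {l m n : ℕ} (hlm : l ≤ m) (hln : l ≤ n)
    (hmn : m + n + 1 < p) : IsUnitMulZPow (Oring ζ) (1 - ζ) (2 * l) (Ccoef A l m n) := by
  have hh : 1 - ζ ≠ 0 := sub_ne_zero.mpr (hζ.ne_one hp.one_lt).symm
  have hq {k : ℕ} (hk : k < p) := isUnitMulZPow_qfact hp hp2 hζ hA hk
  have hsign : IsUnitMulZPow (Oring ζ) (1 - ζ) 0 ((-1) ^ l) := by
    simpa using IsUnitMulZPow.of_isUnit (S := Oring ζ) (h := 1 - ζ) (isUnit_one.neg.pow l)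
  have h := (hsign.mul hh (((hq (k := m) (by omega)).mul hh (hq (k := n) (by omega))).mul hh
    (hq hmn))).div hh ((((hq (k := m - l) (by omega)).mul hh (hq (k := n - l) (by omega))).mul hh
    (hq (k := m + n + 1 - l) (by omega))).mul hh (hq (k := l) (by omega)))
  rw [Ccoef]
  convert h using 1
  omega

end Cyclotomic

/-- Theorem 4.8, valuation of the summands of the matrix coefficients of `t*`:
`b^{(c)}_{n,m,l} = C^l_{l+n-m, m+c}·(γ_{l+n-m}/{l+n-m}!)·({n}!/{m}!)` lies in
`O = ℤ[ζ]` and equals a unit of `O` times `h^l`, where `h = 1-ζ`. -/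
theorem stmt8 (p : ℕ) (hp : p.Prime) (hp5 : 5 ≤ p) (ζ : ℂ)
    (hζ : IsPrimitiveRoot ζ p) (A : ℂ) (hA : A = -ζ ^ ((p - 1) / 2 + 1))
    (c m n l : ℕ) (hc : c ≤ (p - 1) / 2 - 1) (hmn : m ≤ n)
    (hn : n ≤ (p - 1) / 2 - c - 1) (hl : l ≤ m + c) :
    Ccoef A l (l + n - m) (m + c) * (gammaCoef A (l + n - m) / qfact A (l + n - m)) *
        (qfact A n / qfact A m) ∈ Oring ζ ∧
    ∃ u : (Oring ζ)ˣ,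
      Ccoef A l (l + n - m) (m + c) * (gammaCoef A (l + n - m) / qfact A (l + n - m)) *
          (qfact A n / qfact A m) =
        ((u : Oring ζ) : ℂ) * (1 - ζ) ^ l := by
  have hh : 1 - ζ ≠ 0 := sub_ne_zero.mpr (hζ.ne_one hp.one_lt).symm
  have hp2 : p ≠ 2 := by omega
  have hq {k : ℕ} (hk : k < p) := isUnitMulZPow_qfact hp hp2 hζ hA hk
  have hC := isUnitMulZPow_Ccoef hp hp2 hζ hA (l := l) (m := l + n - m) (n := m + c)
    (by omega) hl (by omega)
  have hγ := isUnitMulZPow_gammaCoef hp hp2 hζ hA (m := l + n - m) (by omega)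
  have h := (hC.mul hh (hγ.div hh (hq (k := l + n - m) (by omega)))).mul hh
    ((hq (k := n) (by omega)).div hh (hq (k := m) (by omega)))
  obtain ⟨u, hu⟩ := h
  rw [show (2 * l + (0 - ((l + n - m : ℕ) : ℤ)) + ((n : ℤ) - m)) = (l : ℤ) by omega,
    zpow_natCast] at hu
  refine ⟨?_, u, hu⟩
  rw [hu]
  exact ((u : Oring ζ) * (1 - Oring.gen ζ) ^ l).2
end

section
/- Let p ≥ 5 be prime, d = (p-1)/2, fix c with 0 ≤ c ≤ d-1 and set D = d-c-1. Define (D+1)×(D+1) matrices over ℤ/pℤ, indexed by 0 ≤ m, n ≤ D: Â with Â_{m,n} = (-1)^{n-m}·(2c+2n+1)!!·((n-m)!·(2c+2m+1)!!)^{-1} if m ≤ n and 0 otherwise, and B̂ with B̂_{m,n} = C(m,n)·((-2)^{m-n})^{-1} if n ≤ m and 0 otherwise. Then Â·B̂·Â = B̂·Â·B̂, (Â·B̂·Â)^4 = Id, Â^p = Id, and B̂^p = Id. -/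
open Finset Matrix

/-- The double factorial of the odd number `2k+1`: `(2k+1)!! = 1·3·5⋯(2k+1)`. -/
def oddDFact (k : ℕ) : ℕ := ∏ i ∈ Finset.range (k + 1), (2 * i + 1)

/-- The mod-`h` matrix `Â` of the twist `t` (Lemma 5.5):
`Â_{m,n} = (-1)^{n-m}·(2c+2n+1)!!·((n-m)!·(2c+2m+1)!!)⁻¹` for `m ≤ n`, else `0`. -/
def Ahat (p c D : ℕ) : Matrix (Fin (D + 1)) (Fin (D + 1)) (ZMod p) :=
  Matrix.of fun m n =>
    if (m : ℕ) ≤ (n : ℕ) then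
      (-1 : ZMod p) ^ ((n : ℕ) - (m : ℕ)) * ((oddDFact (c + (n : ℕ)) : ℕ) : ZMod p) *
        (((((n : ℕ) - (m : ℕ)).factorial * oddDFact (c + (m : ℕ)) : ℕ)) : ZMod p)⁻¹
    else 0

/-- The mod-`h` matrix `B̂` of the twist `t*` (Lemma 5.5):
`B̂_{m,n} = C(m,n)·((-2)^{m-n})⁻¹` for `n ≤ m`, else `0`. -/
def Bhat (p D : ℕ) : Matrix (Fin (D + 1)) (Fin (D + 1)) (ZMod p) :=
  Matrix.of fun m n =>
    if (n : ℕ) ≤ (m : ℕ) then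
      ((Nat.choose (m : ℕ) (n : ℕ) : ℕ) : ZMod p) *
        ((-2 : ZMod p) ^ ((m : ℕ) - (n : ℕ)))⁻¹
    else 0

section SymmetricPower

open Polynomial

variable {R : Type*} [CommRing R]

/-- The value at `(u, v)` of the degree-`D` homogenization of `P`, for `P` of degree at most `D`. -/
def homEval {S : Type*} [CommRing S] [Algebra R S] (D : ℕ) (P : R[X]) (u v : S) : S :=
  ∑ n ∈ range (D + 1), algebraMap R S (P.coeff n) * (u ^ n * v ^ (D - n))

/-- The linear polynomial `g i 0 * X + g i 1` attached to the `i`-th row of a matrix. -/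
noncomputable def rowLinear (g : Matrix (Fin 2) (Fin 2) R) (i : Fin 2) : R[X] :=
  C (g i 0) * X + C (g i 1)

lemma natDegree_rowLinear_pow_mul_pow_le (g : Matrix (Fin 2) (Fin 2) R) (m k : ℕ) :
    (rowLinear g 0 ^ m * rowLinear g 1 ^ k).natDegree ≤ m + k := by
  refine natDegree_mul_le_of_le ?_ ?_
  · simpa [rowLinear] using natDegree_pow_le_of_le m (natDegree_linear_le (a := g 0 0) (b := g 0 1))
  · simpa [rowLinear] using natDegree_pow_le_of_le k (natDegree_linear_le (a := g 1 0) (b := g 1 1))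

lemma homEval_linear_mul {S : Type*} [CommRing S] [Algebra R S] {D : ℕ} {P : R[X]}
    (hP : P.natDegree ≤ D) (a b : R) (u v : S) :
    homEval (D + 1) ((C a * X + C b) * P) u v =
      (algebraMap R S a * u + algebraMap R S b * v) * homEval D P u v := by
  have hX : homEval (D + 1) (X * P) u v = u * homEval D P u v := by
    unfold homEval
    rw [sum_range_succ', mul_sum]
    simp only [coeff_X_mul, mul_coeff_zero, coeff_X_zero, zero_mul, map_zero, add_zero]
    refine sum_congr rfl fun n _ => ?_
    rw [Nat.add_sub_add_right]
    ring
  have hv : homEval (D + 1) P u v = v * homEval D P u v := by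
    unfold homEval
    rw [sum_range_succ, coeff_eq_zero_of_natDegree_lt (Nat.lt_succ_of_le hP), mul_sum]
    simp only [map_zero, zero_mul, add_zero]
    refine sum_congr rfl fun n hn => ?_
    rw [Nat.succ_sub (Nat.lt_succ_iff.mp (mem_range.mp hn)), pow_succ]
    ring
  have hadd : homEval (D + 1) ((C a * X + C b) * P) u v =
      algebraMap R S a * homEval (D + 1) (X * P) u v +
        algebraMap R S b * homEval (D + 1) P u v := by
    unfold homEval
    rw [mul_sum, mul_sum, ← sum_add_distrib]
    refine sum_congr rfl fun n _ => ?_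
    rw [add_mul, mul_assoc, coeff_add, coeff_C_mul, coeff_C_mul, map_add, map_mul, map_mul]
    ring
  rw [hadd, hX, hv]
  ring

lemma homEval_rowLinear_pow_mul_pow {S : Type*} [CommRing S] [Algebra R S]
    (g : Matrix (Fin 2) (Fin 2) R) (u v : S) (m k : ℕ) :
    homEval (m + k) (rowLinear g 0 ^ m * rowLinear g 1 ^ k) u v =
      (algebraMap R S (g 0 0) * u + algebraMap R S (g 0 1) * v) ^ m *
        (algebraMap R S (g 1 0) * u + algebraMap R S (g 1 1) * v) ^ k := by
  induction m with
  | zero =>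
    induction k with
    | zero => simp [homEval]
    | succ k ih =>
      have h := homEval_linear_mul (natDegree_rowLinear_pow_mul_pow_le g 0 k)
        (g 1 0) (g 1 1) u v
      rw [ih] at h
      rw [← add_assoc, pow_succ' (rowLinear g 1), mul_left_comm]
      refine h.trans ?_
      ring
  | succ m ih =>
    have h := homEval_linear_mul (natDegree_rowLinear_pow_mul_pow_le g m k)
      (g 0 0) (g 0 1) u v
    rw [ih] at h
    rw [Nat.add_right_comm, pow_succ' (rowLinear g 0), mul_assoc]
    refine h.trans ?_
    ring

lemma rowLinear_mul (g h : Matrix (Fin 2) (Fin 2) R) (i : Fin 2) :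
    rowLinear (g * h) i = C (g i 0) * rowLinear h 0 + C (g i 1) * rowLinear h 1 := by
  simp only [rowLinear, Matrix.mul_apply, Fin.sum_univ_two, map_add, map_mul]
  ring

/-- The matrix of the `D`-th symmetric power of `g`, in the basis of monomials. -/
noncomputable def symPow (D : ℕ) :
    Matrix (Fin 2) (Fin 2) R →* Matrix (Fin (D + 1)) (Fin (D + 1)) R where
  toFun g := Matrix.of fun m n =>
    (rowLinear g 0 ^ (m : ℕ) * rowLinear g 1 ^ (D - m : ℕ)).coeff n
  map_one' := by
    ext m n
    simp [rowLinear, Matrix.one_apply, coeff_X_pow, Fin.ext_iff, eq_comm]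
  map_mul' g h := by
    ext m j
    have key := homEval_rowLinear_pow_mul_pow g (rowLinear h 0) (rowLinear h 1) m (D - m)
    rw [Nat.add_sub_cancel' (Nat.lt_succ_iff.mp m.2)] at key
    simp only [algebraMap_eq, ← rowLinear_mul] at key
    simp only [Matrix.of_apply, Matrix.mul_apply]
    rw [← key, homEval, finsetSum_coeff, ← Fin.sum_univ_eq_sum_range (fun n =>
      (algebraMap R R[X] ((rowLinear g 0 ^ (m : ℕ) * rowLinear g 1 ^ (D - m : ℕ)).coeff n) *
        (rowLinear h 0 ^ n * rowLinear h 1 ^ (D - n))).coeff j)]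
    simp only [algebraMap_eq, coeff_C_mul]

lemma symPow_apply (D : ℕ) (g : Matrix (Fin 2) (Fin 2) R) (m n : Fin (D + 1)) :
    symPow D g m n = (rowLinear g 0 ^ (m : ℕ) * rowLinear g 1 ^ (D - m : ℕ)).coeff n :=
  rfl

lemma symPow_lower_apply (D : ℕ) (r : R) (m n : Fin (D + 1)) :
    symPow D !![1, 0; r, 1] m n =
      if (m : ℕ) ≤ n then r ^ (n - m : ℕ) * ((D - m).choose (n - m) : ℕ) else 0 := by
  have h : (C r * X + 1 : R[X]) ^ (D - m : ℕ) = ((1 + X) ^ (D - m : ℕ)).comp (C r * X) := by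
    simp [add_comm]
  rw [symPow_apply]
  simp only [rowLinear, of_apply, cons_val', cons_val_zero, cons_val_one, cons_val_fin_one, map_one,
    one_mul, map_zero, add_zero]
  rw [coeff_X_pow_mul', h, comp_C_mul_X_coeff, coeff_one_add_X_pow]
  simp only [mul_comm]

lemma symPow_upper_apply (D : ℕ) (r : R) (m n : Fin (D + 1)) :
    symPow D !![1, r; 0, 1] m n = r ^ (m - n : ℕ) * ((m : ℕ).choose n : ℕ) := by
  rw [symPow_apply]
  simp [rowLinear, coeff_X_add_C_pow]

lemma lower_unipotent_pow (r : R) (n : ℕ) :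
    (!![1, 0; r, 1] : Matrix (Fin 2) (Fin 2) R) ^ n = !![1, 0; n * r, 1] := by
  induction n with
  | zero => simp [Matrix.one_fin_two]
  | succ n ih => rw [pow_succ, ih]; simp [add_mul]

lemma upper_unipotent_pow (r : R) (n : ℕ) :
    (!![1, r; 0, 1] : Matrix (Fin 2) (Fin 2) R) ^ n = !![1, n * r; 0, 1] := by
  induction n with
  | zero => simp [Matrix.one_fin_two]
  | succ n ih => rw [pow_succ, ih]; simp [add_mul, add_comm]

lemma unipotent_braid {r s : R} (h : r * s = -1) :
    (!![1, 0; r, 1] * !![1, s; 0, 1] * !![1, 0; r, 1] : Matrix (Fin 2) (Fin 2) R) =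
      !![1, s; 0, 1] * !![1, 0; r, 1] * !![1, s; 0, 1] := by
  have h' : s * r = -1 := by rw [mul_comm, h]
  simp [h, h']

lemma unipotent_braid_pow_four {r s : R} (h : r * s = -1) :
    (!![1, 0; r, 1] * !![1, s; 0, 1] * !![1, 0; r, 1] : Matrix (Fin 2) (Fin 2) R) ^ 4 = 1 := by
  have h' : s * r = -1 := by rw [mul_comm, h]
  have h_sq : (!![1, 0; r, 1] * !![1, s; 0, 1] * !![1, 0; r, 1] :
      Matrix (Fin 2) (Fin 2) R) ^ 2 = !![-1, 0; 0, -1] := by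
    simp [pow_two, h, h']
  rw [pow_mul _ 2 2, h_sq]
  simp [pow_two, Matrix.one_fin_two]

end SymmetricPower

lemma oddDFact_succ (k : ℕ) : oddDFact (k + 1) = oddDFact k * (2 * (k + 1) + 1) :=
  prod_range_succ _ _

lemma oddDFact_cast_ne_zero {p : ℕ} (hp : p.Prime) {k : ℕ} (hk : 2 * k + 1 < p) :
    (oddDFact k : ZMod p) ≠ 0 := by
  rw [Ne, ZMod.natCast_eq_zero_iff, oddDFact, hp.prime.dvd_finsetProd_iff]
  rintro ⟨i, hi, hdvd⟩
  have := Nat.le_of_dvd (Nat.succ_pos _) hdvd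
  rw [mem_range] at hi
  omega

lemma neg_one_pow_mul_oddDFact_add {p c D m k : ℕ} (hD : 2 * c + 2 * D + 3 = p)
    (hk : m + k ≤ D) :
    (-1 : ZMod p) ^ k * (oddDFact (c + m + k) : ZMod p) =
      2 ^ k * ((D - m).descFactorial k : ZMod p) * (oddDFact (c + m) : ZMod p) := by
  induction k with
  | zero => simp
  | succ k ih =>
    have hz : (2 * c + 2 * D + 3 : ZMod p) = 0 := by
      rw [← ZMod.natCast_self p, ← hD]
      push_cast
      rfl
    have ih' := ih (by omega)
    rw [← add_assoc, oddDFact_succ, Nat.descFactorial_succ, Nat.sub_sub]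
    push_cast [Nat.cast_sub (show m + k ≤ D by omega)]
    linear_combination (2 * ((D : ZMod p) - (m + k))) * ih' -
      (-1 : ZMod p) ^ k * (oddDFact (c + m + k) : ZMod p) * hz

lemma Ahat_eq_symPow {p c D : ℕ} (hp : p.Prime) (hD : 2 * c + 2 * D + 3 = p) :
    Ahat p c D = symPow D !![1, 0; 2, 1] := by
  have := Fact.mk hp
  ext m n
  rw [symPow_lower_apply, Ahat, Matrix.of_apply]
  refine if_ctx_congr Iff.rfl (fun hmn => ?_) fun _ => rfl
  have hn := n.2
  obtain ⟨k, hk⟩ := Nat.exists_eq_add_of_le hmn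
  have key := neg_one_pow_mul_oddDFact_add (m := m) (k := k) hD (by omega)
  have hfact : (k.factorial : ZMod p) ≠ 0 := by
    rw [Ne, ZMod.natCast_eq_zero_iff, hp.dvd_factorial]
    omega
  have hodd : (oddDFact (c + m) : ZMod p) ≠ 0 := oddDFact_cast_ne_zero hp (by omega)
  rw [hk, Nat.add_sub_cancel_left, ← add_assoc, key, Nat.descFactorial_eq_factorial_mul_choose]
  push_cast
  field_simp

lemma Bhat_eq_symPow (p D : ℕ) [Fact p.Prime] :
    Bhat p D = symPow D !![1, (-2)⁻¹; 0, 1] := by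
  ext m n
  rw [symPow_upper_apply, Bhat, Matrix.of_apply]
  split_ifs with hnm
  · rw [inv_pow, mul_comm]
  · rw [Nat.choose_eq_zero_of_lt (not_le.mp hnm), Nat.cast_zero, mul_zero]

/-- Part of Theorem 5.1: with `p ≥ 5` prime, `d = (p-1)/2`, `0 ≤ c ≤ d-1` and
`D = d-c-1`, the mod-`h` twist matrices satisfy the braid relation
`Â·B̂·Â = B̂·Â·B̂`, together with `(Â·B̂·Â)⁴ = 1`, `Â^p = 1` and `B̂^p = 1`;
hence `ρ_{p,0}` factors through `SL(2,𝔽_p)`. -/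
theorem stmt13 (p : ℕ) (hp : p.Prime) (hp5 : 5 ≤ p)
    (c : ℕ) (hc : c ≤ (p - 1) / 2 - 1) :
    Ahat p c ((p - 1) / 2 - c - 1) * Bhat p ((p - 1) / 2 - c - 1) *
          Ahat p c ((p - 1) / 2 - c - 1) =
        Bhat p ((p - 1) / 2 - c - 1) * Ahat p c ((p - 1) / 2 - c - 1) *
          Bhat p ((p - 1) / 2 - c - 1) ∧
    (Ahat p c ((p - 1) / 2 - c - 1) * Bhat p ((p - 1) / 2 - c - 1) *
          Ahat p c ((p - 1) / 2 - c - 1)) ^ 4 = 1 ∧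
    Ahat p c ((p - 1) / 2 - c - 1) ^ p = 1 ∧
    Bhat p ((p - 1) / 2 - c - 1) ^ p = 1 := by
  have := Fact.mk hp
  have hodd : p % 2 = 1 := Nat.odd_iff.mp (hp.odd_of_ne_two (by omega))
  have h2 : (-2 : ZMod p) ≠ 0 := by
    rw [neg_ne_zero]
    intro h
    have := Nat.le_of_dvd two_pos ((ZMod.natCast_eq_zero_iff 2 p).mp (by exact_mod_cast h))
    omega
  have hrs : (2 : ZMod p) * (-2)⁻¹ = -1 := by
    linear_combination -mul_inv_cancel₀ h2
  rw [Ahat_eq_symPow hp (by omega), Bhat_eq_symPow]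
  simp only [← map_mul, ← map_pow]
  refine ⟨by rw [unipotent_braid hrs], by rw [unipotent_braid_pow_four hrs, map_one], ?_, ?_⟩
  · rw [lower_unipotent_pow, ZMod.natCast_self, zero_mul, ← Matrix.one_fin_two, map_one]
  · rw [upper_unipotent_pow, ZMod.natCast_self, zero_mul, ← Matrix.one_fin_two, map_one]
end
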